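/- Fix an integer n ≥ 1, a sign assignment s, and a Maslov grading gr, and let (CD, δ) be the complex of positive domains defined from them. Then δ ∘ δ = 0, i.e., (CD, δ) is a chain complex. -/

import Mathlib

/-! Grid diagram combinatorics: the complex of positive domains `CD₊`. -/

/-- A domain on the `n × n` toroidal grid from grid state `x` to grid state `y`,
avoiding the distinguished top-right square. -/
def IsGridDomain (n : ℕ) (x y : Equiv.Perm (ZMod n)) (D : ZMod n → ZMod n → ℤ) : Prop :=
  D ((n : ZMod n) - 1) ((n : ZMod n) - 1) = 0 ∧
    ∀ i j : ZMod n,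
      D i j - D (i - 1) j - D i (j - 1) + D (i - 1) (j - 1) =
        (if x i = j then 1 else 0) - (if y i = j then 1 else 0)

/-- A positive domain from `x` to `y`. -/
def IsGridPosDomain (n : ℕ) (x y : Equiv.Perm (ZMod n)) (D : ZMod n → ZMod n → ℤ) : Prop :=
  IsGridDomain n x y D ∧ ∀ i j : ZMod n, 0 ≤ D i j

/-- Membership in the cyclic interval `[a, b)` of `ZMod n`. -/
def cycInt (n : ℕ) (a b i : ZMod n) : Prop :=
  ∃ k : ℕ, k < (b - a).val ∧ i = a + (k : ZMod n)

/-- A rectangle from `x` to `y`. -/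
def IsGridRect (n : ℕ) (x y : Equiv.Perm (ZMod n)) (R : ZMod n → ZMod n → ℤ) : Prop :=
  IsGridPosDomain n x y R ∧
    ∃ i₁ i₂ : ZMod n, i₁ ≠ i₂ ∧
      y = x * Equiv.swap i₁ i₂ ∧
      (∀ i j : ZMod n,
        (cycInt n i₁ i₂ i ∧ cycInt n (x i₁) (x i₂) j → R i j = 1) ∧
        (¬(cycInt n i₁ i₂ i ∧ cycInt n (x i₁) (x i₂) j) → R i j = 0)) ∧
      ∀ i : ZMod n, i ≠ i₁ → i ≠ i₂ → cycInt n i₁ i₂ i → ¬ cycInt n (x i₁) (x i₂) (x i)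

/-- The horizontal annulus through row `j`. -/
def annH (n : ℕ) (j : ZMod n) : ZMod n → ZMod n → ℤ := fun _ j' => if j' = j then 1 else 0

/-- The vertical annulus through column `i`. -/
def annV (n : ℕ) (i : ZMod n) : ZMod n → ZMod n → ℤ := fun i' _ => if i' = i then 1 else 0

/-- `A(D)`: multiplicities of `D` in the rightmost column. -/
def colA (n : ℕ) (D : ZMod n → ZMod n → ℤ) : {j : ZMod n // j ≠ (n : ZMod n) - 1} → ℤ :=
  fun j => D ((n : ZMod n) - 1) j.1

/-- `B(D)`: multiplicities of `D` in the topmost row. -/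
def rowB (n : ℕ) (D : ZMod n → ZMod n → ℤ) : {i : ZMod n // i ≠ (n : ZMod n) - 1} → ℤ :=
  fun i => D i.1 ((n : ZMod n) - 1)

/-- A sign assignment on rectangles. -/
structure SignAssignment (n : ℕ) where
  s : Equiv.Perm (ZMod n) → Equiv.Perm (ZMod n) → (ZMod n → ZMod n → ℤ) → ℤ
  s_unit : ∀ x w R, IsGridRect n x w R → s x w R = 1 ∨ s x w R = -1
  s_square : ∀ x y w₁ w₂ R₁ S₁ R₂ S₂,
    IsGridRect n x w₁ R₁ → IsGridRect n w₁ y S₁ →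
    IsGridRect n x w₂ R₂ → IsGridRect n w₂ y S₂ →
    R₁ + S₁ = R₂ + S₂ →
    (w₁, R₁, S₁) ≠ (w₂, R₂, S₂) →
    (∀ j : ZMod n, j ≠ (n : ZMod n) - 1 → R₁ + S₁ ≠ annH n j) →
    (∀ i : ZMod n, i ≠ (n : ZMod n) - 1 → R₁ + S₁ ≠ annV n i) →
    s x w₁ R₁ * s w₁ y S₁ = -(s x w₂ R₂ * s w₂ y S₂)
  s_horiz : ∀ x w R S, ∀ j : ZMod n, j ≠ (n : ZMod n) - 1 →
    IsGridRect n x w R → IsGridRect n w x S → R + S = annH n j →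
    s x w R * s w x S = 1
  s_vert : ∀ x w R S, ∀ i : ZMod n, i ≠ (n : ZMod n) - 1 →
    IsGridRect n x w R → IsGridRect n w x S → R + S = annV n i →
    s x w R * s w x S = -1

/-- A Maslov grading on positive domains. -/
structure MaslovGrading (n : ℕ) where
  gr : Equiv.Perm (ZMod n) → Equiv.Perm (ZMod n) → (ZMod n → ZMod n → ℤ) → ℤ
  gr_zero : ∀ x, gr x x 0 = 0
  gr_left : ∀ x w y R E, IsGridRect n x w R → IsGridPosDomain n w y E →
    gr x y (R + E) = 1 + gr w y E
  gr_right : ∀ x w y E R, IsGridPosDomain n x w E → IsGridRect n w y R →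
    gr x y (E + R) = 1 + gr x w E

/-- Generators of the complex of positive domains: triples `(x, y, D)` with
`D` a positive domain from `x` to `y`. -/
abbrev GenCD (n : ℕ) :=
  {p : Equiv.Perm (ZMod n) × Equiv.Perm (ZMod n) × (ZMod n → ZMod n → ℤ) //
    IsGridPosDomain n p.1 p.2.1 p.2.2}

/-- The complex of positive domains, as a free `ℤ`-module. -/
abbrev CDModule (n : ℕ) := GenCD n →₀ ℤ

/-- The differential of the complex of positive domains. -/
noncomputable def deltaCD (n : ℕ) (sgn : SignAssignment n) (grd : MaslovGrading n) :
    CDModule n →ₗ[ℤ] CDModule n :=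
  Finsupp.lift (CDModule n) ℤ (GenCD n) fun g =>
    (∑ᶠ (w : Equiv.Perm (ZMod n)) (R : ZMod n → ZMod n → ℤ) (E : ZMod n → ZMod n → ℤ)
        (_ : IsGridRect n g.1.1 w R) (hE : IsGridPosDomain n w g.1.2.1 E)
        (_ : R + E = g.1.2.2),
        sgn.s g.1.1 w R • Finsupp.single (⟨(w, g.1.2.1, E), hE⟩ : GenCD n) (1 : ℤ)) +
    (((-1 : ℤˣ) ^ grd.gr g.1.1 g.1.2.1 g.1.2.2 : ℤˣ) : ℤ) •
      (∑ᶠ (w : Equiv.Perm (ZMod n)) (E : ZMod n → ZMod n → ℤ) (R : ZMod n → ZMod n → ℤ)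
        (hE : IsGridPosDomain n g.1.1 w E) (_ : IsGridRect n w g.1.2.1 R)
        (_ : E + R = g.1.2.2),
        sgn.s w g.1.2.1 R • Finsupp.single (⟨(g.1.1, w, E), hE⟩ : GenCD n) (1 : ℤ))


namespace GridCD

theorem val_sub_spec {n : ℕ} [NeZero n] (i a : ZMod n) :
    (a.val ≤ i.val ∧ (i - a).val = i.val - a.val) ∨
      (i.val < a.val ∧ (i - a).val = n + i.val - a.val) := by
  have h := ZMod.val_add (i - a) a
  rw [sub_add_cancel] at h
  have h1 := ZMod.val_lt i
  have h2 := ZMod.val_lt a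
  have h3 := ZMod.val_lt (i - a)
  rcases lt_or_ge ((i - a).val + a.val) n with h4 | h4
  · rw [Nat.mod_eq_of_lt h4] at h; omega
  · rw [Nat.mod_eq_sub_mod h4, Nat.mod_eq_of_lt (by omega)] at h; omega

theorem cyc_iff_val {n : ℕ} [NeZero n] (a b i : ZMod n) :
    cycInt n a b i ↔ (i - a).val < (b - a).val := by
  constructor
  · rintro ⟨k, hk, rfl⟩
    have := ZMod.val_lt (b - a)
    rw [add_sub_cancel_left, ZMod.val_natCast, Nat.mod_eq_of_lt (by omega)]
    exact hk
  · intro h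
    exact ⟨(i - a).val, h, by simp⟩

theorem cyc_iff {n : ℕ} [NeZero n] (a b i : ZMod n) :
    cycInt n a b i ↔ (a.val ≤ i.val ∧ i.val < b.val) ∨
      (b.val < a.val ∧ (i.val < b.val ∨ a.val ≤ i.val)) := by
  rw [cyc_iff_val]
  have := val_sub_spec i a
  have := val_sub_spec b a
  have h1 := ZMod.val_lt i
  have h2 := ZMod.val_lt a
  have h3 := ZMod.val_lt b
  omega

theorem val_ne {n : ℕ} [NeZero n] {a b : ZMod n} : a ≠ b ↔ a.val ≠ b.val :=
  (ZMod.val_injective n).ne_iff.symm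

theorem val_eq {n : ℕ} [NeZero n] {a b : ZMod n} : a = b ↔ a.val = b.val :=
  (ZMod.val_injective n).eq_iff.symm

open Classical in
/-- Indicator of the cyclic interval. -/
noncomputable def ind (n : ℕ) (a b i : ZMod n) : ℤ := if cycInt n a b i then 1 else 0

theorem ind_nonneg {n : ℕ} (a b i : ZMod n) : 0 ≤ ind n a b i := by
  unfold ind; split_ifs <;> simp

theorem ind_sub {n : ℕ} [NeZero n] (a b i : ZMod n) :
    ind n a b i - ind n a b (i - 1) = (if i = a then 1 else 0) - (if i = b then 1 else 0) := by
  unfold ind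
  simp only [cyc_iff, val_eq]
  have h0 := val_sub_spec i 1
  rw [ZMod.val_one_eq_one_mod] at h0
  have h1 := ZMod.val_lt i
  have h2 := ZMod.val_lt a
  have h3 := ZMod.val_lt b
  have h4 : n = 1 ∨ 1 % n = 1 := by
    have := NeZero.ne n
    rcases Nat.lt_or_ge 1 n with h | h
    · right; exact Nat.mod_eq_of_lt h
    · left; omega
  rcases h4 with h4 | h4
  · subst h4
    split_ifs <;> omega
  · rw [h4] at h0
    split_ifs <;> omega

/-- additivity of cyclic intervals -/
theorem ind_add {n : ℕ} [NeZero n] {a b c : ZMod n} (h : cycInt n a c b) (i : ZMod n) :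
    ind n a c i = ind n a b i + ind n b c i := by
  unfold ind
  simp only [cyc_iff] at *
  split_ifs <;> omega

theorem cyc_or {n : ℕ} [NeZero n] {a b c : ZMod n} (h : cycInt n a c b) (i : ZMod n) :
    cycInt n a c i ↔ cycInt n a b i ∨ cycInt n b c i := by
  simp only [cyc_iff] at *
  omega

/-- The indicator function of a rectangle. -/
noncomputable def rf (n : ℕ) (a b A B : ZMod n) : ZMod n → ZMod n → ℤ :=
  fun i j => ind n a b i * ind n A B j

theorem rf_nonneg {n : ℕ} (a b A B i j : ZMod n) : 0 ≤ rf n a b A B i j :=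
  mul_nonneg (ind_nonneg _ _ _) (ind_nonneg _ _ _)

/-- Data of a rectangle -/
structure RD (n : ℕ) (x y : Equiv.Perm (ZMod n)) (R : ZMod n → ZMod n → ℤ) (a b : ZMod n) :
    Prop where
  ne : a ≠ b
  ya : y a = x b
  yb : y b = x a
  yk : ∀ k, k ≠ a → k ≠ b → y k = x k
  R_eq : R = rf n a b (x a) (x b)
  corner : R ((n : ZMod n) - 1) ((n : ZMod n) - 1) = 0
  empty : ∀ k, k ≠ a → k ≠ b → cycInt n a b k → ¬ cycInt n (x a) (x b) (x k)

theorem RD_of_rect {n : ℕ} {x y : Equiv.Perm (ZMod n)} {R : ZMod n → ZMod n → ℤ}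
    (h : IsGridRect n x y R) : ∃ a b, RD n x y R a b := by
  obtain ⟨⟨⟨h1, -⟩, -⟩, a, b, hab, rfl, hR, he⟩ := h
  refine ⟨a, b, hab, by simp, by simp, ?_, ?_, h1, he⟩
  · intro k ha hb
    simp [Equiv.swap_apply_of_ne_of_ne ha hb]
  · funext i j
    by_cases hc : cycInt n a b i ∧ cycInt n (x a) (x b) j
    · rw [(hR i j).1 hc]; simp [rf, ind, hc]
    · rw [(hR i j).2 hc]
      simp only [rf, ind]
      split_ifs <;> simp_all

theorem RD.rect {n : ℕ} [NeZero n] {x y : Equiv.Perm (ZMod n)} {R : ZMod n → ZMod n → ℤ}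
    {a b : ZMod n} (h : RD n x y R a b) : IsGridRect n x y R := by
  obtain ⟨hab, ya, yb, yk, rfl, hc, he⟩ := h
  refine ⟨⟨⟨hc, ?_⟩, fun i j => rf_nonneg _ _ _ _ _ _⟩, a, b, hab, ?_, ?_, he⟩
  · intro i j
    have e : rf n a b (x a) (x b) i j - rf n a b (x a) (x b) (i - 1) j
        - rf n a b (x a) (x b) i (j - 1) + rf n a b (x a) (x b) (i - 1) (j - 1) =
        (ind n a b i - ind n a b (i - 1)) *
          (ind n (x a) (x b) j - ind n (x a) (x b) (j - 1)) := by
      simp only [rf]; ring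
    rw [e, ind_sub, ind_sub]
    have hx : x a ≠ x b := fun h => hab (x.injective h)
    by_cases ha : i = a
    · subst ha
      rw [ya]
      simp [hab, eq_comm]
    · by_cases hb : i = b
      · subst hb
        rw [yb]
        simp [ha, eq_comm]
      · rw [yk i ha hb]; simp [ha, hb]
  · ext k
    by_cases ha : k = a
    · subst ha; simp [ya]
    · by_cases hb : k = b
      · subst hb; simp [yb]
      · rw [yk k ha hb]; simp [Equiv.swap_apply_of_ne_of_ne ha hb]
  · intro i j
    constructor
    · rintro ⟨h1, h2⟩; simp [rf, ind, h1, h2]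
    · intro h
      simp only [rf, ind]
      split_ifs <;> simp_all

/-- Existence of another decomposition. -/
def Alt (n : ℕ) (x w y : Equiv.Perm (ZMod n)) (F : ZMod n → ZMod n → ℤ) : Prop :=
  ∃ w' R' S', IsGridRect n x w' R' ∧ IsGridRect n w' y S' ∧ R' + S' = F ∧ w' ≠ w

theorem mk_alt {n : ℕ} [NeZero n] {x w y : Equiv.Perm (ZMod n)} {F : ZMod n → ZMod n → ℤ}
    (hF : F ((n : ZMod n) - 1) ((n : ZMod n) - 1) = 0)
    (p q r t P Q P' Q' : ZMod n) (hpq : p ≠ q) (hrt : r ≠ t)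
    (hP : x p = P) (hQ : x q = Q)
    (hw : ∀ w' : Equiv.Perm (ZMod n), w' p = Q → w' q = P →
      (∀ k, k ≠ p → k ≠ q → w' k = x k) →
      (w' r = P' ∧ w' t = Q' ∧ y r = Q' ∧ y t = P' ∧ (∀ k, k ≠ r → k ≠ t → y k = w' k)) ∧
      w' ≠ w ∧ (∀ k, k ≠ r → k ≠ t → cycInt n r t k → ¬ cycInt n P' Q' (w' k)))
    (he : ∀ k, k ≠ p → k ≠ q → cycInt n p q k → ¬ cycInt n P Q (x k))
    (hs : ∀ i j, ind n p q i * ind n P Q j + ind n r t i * ind n P' Q' j = F i j) :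
    Alt n x w y F := by
  subst hP hQ
  obtain ⟨⟨e1, e2, e3, e4, e5⟩, e6, e7⟩ := hw (x * Equiv.swap p q) (by simp) (by simp)
    (fun k h1 h2 => by simp [Equiv.swap_apply_of_ne_of_ne h1 h2])
  have hs' : rf n p q (x p) (x q) + rf n r t P' Q' = F := by
    funext i j; exact hs i j
  have c := congrFun (congrFun hs' ((n : ZMod n) - 1)) ((n : ZMod n) - 1)
  rw [hF] at c
  simp only [Pi.add_apply] at c
  have c1 := rf_nonneg p q (x p) (x q) ((n : ZMod n) - 1) ((n : ZMod n) - 1)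
  have c2 := rf_nonneg r t P' Q' ((n : ZMod n) - 1) ((n : ZMod n) - 1)
  refine ⟨x * Equiv.swap p q, rf n p q (x p) (x q), rf n r t P' Q', ?_, ?_, hs', e6⟩
  · exact RD.rect (a := p) (b := q) ⟨hpq, by simp, by simp,
      fun k h1 h2 => by simp [Equiv.swap_apply_of_ne_of_ne h1 h2], rfl, by omega, he⟩
  · refine RD.rect (a := r) (b := t) ⟨hrt, by rw [e3, e2], by rw [e4, e1], e5, ?_, by omega, ?_⟩
    · rw [e1, e2]
    · rw [e1, e2]; exact e7

theorem alt1 {n : ℕ} [NeZero n] {x w y : Equiv.Perm (ZMod n)} {R S : ZMod n → ZMod n → ℤ}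
    {a b c : ZMod n} (hR : RD n x w R a b) (hS : RD n w y S a c) (hcb : c ≠ b) :
    Alt n x w y (R + S) := by
  have hF : (R + S) ((n : ZMod n) - 1) ((n : ZMod n) - 1) = 0 := by
    rw [Pi.add_apply, Pi.add_apply, hR.corner, hS.corner, add_zero]
  obtain ⟨hab, wa, wb, wk, rfl, -, eR⟩ := hR
  obtain ⟨hac, ya, yc, yk, rfl, -, eS⟩ := hS
  have wc := wk c hac.symm hcb
  have yb := yk b hab.symm hcb.symm
  have hAB : x a ≠ x b := x.injective.ne hab
  have hAC : x a ≠ x c := x.injective.ne hac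
  have hCB : x c ≠ x b := x.injective.ne hcb
  have yk' : ∀ k, k ≠ a → k ≠ b → k ≠ c → y k = x k := fun k h1 h2 h3 => by
    rw [yk k h1 h3, wk k h1 h2]
  have eS' : ∀ k, k ≠ a → k ≠ b → k ≠ c → cycInt n a c k → ¬ cycInt n (x b) (x c) (x k) := by
    intro k h1 h2 h3 h4
    have := eS k h1 h3 h4
    rwa [wa, wc, wk k h1 h2] at this
  have eSb := eS b hab.symm hcb.symm
  have eRc := eR c hac.symm hcb
  rw [wa, wc, wb] at eSb
  rw [wa, wc] at hF ⊢
  rw [wc] at ya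
  rw [wa] at yc
  rw [wb] at yb
  have hrow : cycInt n (x a) (x c) (x b) := by
    simp only [cyc_iff, val_ne] at *; omega
  by_cases hcol : cycInt n a c b
  · refine mk_alt hF b c a b (x b) (x c) (x a) (x c) hcb.symm hab rfl rfl ?_ ?_ ?_
    · intro w' w1 w2 w3
      have wa' := w3 a hab hac
      refine ⟨⟨wa', w1, ya, yb, ?_⟩, ?_, ?_⟩
      · intro k h1 h2
        by_cases h3 : k = c
        · rw [h3, w2, yc]
        · rw [yk' k h1 h2 h3, w3 k h2 h3]
      · rintro rfl
        exact hAB (wa'.symm.trans wa)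
      · intro k h1 h2 h3
        by_cases h4 : k = c
        · simp only [cyc_iff, val_ne] at *; subst h4; omega
        · rw [w3 k h2 h4, cyc_or hrow]
          have := eR k h1 h2 h3
          have := eS' k h1 h2 h4 ((cyc_or hcol k).2 (Or.inl h3))
          tauto
    · intro k h1 h2 h3
      by_cases h4 : k = a
      · subst h4; simp only [cyc_iff, val_ne] at *; omega
      · exact eS' k h4 h1 h2 ((cyc_or hcol k).2 (Or.inr h3))
    · intro i j
      simp only [rf, Pi.add_apply, ind_add hrow, ind_add hcol]
      ring
  · have hcol' : cycInt n a b c := by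
      simp only [cyc_iff, val_ne] at *; omega
    refine mk_alt hF a c c b (x a) (x c) (x a) (x b) hac hcb rfl rfl ?_ ?_ ?_
    · intro w' w1 w2 w3
      have wb' := w3 b hab.symm hcb.symm
      refine ⟨⟨w2, wb', yc, yb, ?_⟩, ?_, ?_⟩
      · intro k h1 h2
        by_cases h3 : k = a
        · rw [h3, w1, ya]
        · rw [yk' k h3 h2 h1, w3 k h3 h1]
      · rintro rfl
        exact hCB (w1.symm.trans wa)
      · intro k h1 h2 h3
        by_cases h4 : k = a
        · simp only [cyc_iff, val_ne] at *; subst h4; omega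
        · rw [w3 k h4 h1]
          exact eR k h4 h2 ((cyc_or hcol' k).2 (Or.inr h3))
    · intro k h1 h2 h3
      by_cases h4 : k = b
      · subst h4; simp only [cyc_iff, val_ne] at *; omega
      · rw [cyc_or hrow]
        have := eR k h1 h4 ((cyc_or hcol' k).2 (Or.inl h3))
        have := eS' k h1 h4 h2 h3
        tauto
    · intro i j
      simp only [rf, Pi.add_apply, ind_add hrow, ind_add hcol']
      ring

theorem alt2 {n : ℕ} [NeZero n] {x w y : Equiv.Perm (ZMod n)} {R S : ZMod n → ZMod n → ℤ}
    {a b c : ZMod n} (hR : RD n x w R a b) (hS : RD n w y S b c) (hca : c ≠ a) :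
    Alt n x w y (R + S) := by
  have hF : (R + S) ((n : ZMod n) - 1) ((n : ZMod n) - 1) = 0 := by
    rw [Pi.add_apply, Pi.add_apply, hR.corner, hS.corner, add_zero]
  obtain ⟨hab, wa, wb, wk, rfl, -, eR⟩ := hR
  obtain ⟨hbc, yb, yc, yk, rfl, -, eS⟩ := hS
  have wc := wk c hca hbc.symm
  have ya := yk a hab hca.symm
  have hAB : x a ≠ x b := x.injective.ne hab
  have hCA : x c ≠ x a := x.injective.ne hca
  have hBC : x b ≠ x c := x.injective.ne hbc
  have yk' : ∀ k, k ≠ a → k ≠ b → k ≠ c → y k = x k := fun k h1 h2 h3 => by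
    rw [yk k h2 h3, wk k h1 h2]
  have eS' : ∀ k, k ≠ a → k ≠ b → k ≠ c → cycInt n b c k → ¬ cycInt n (x a) (x c) (x k) := by
    intro k h1 h2 h3 h4
    have := eS k h2 h3 h4
    rwa [wb, wc, wk k h1 h2] at this
  have eSa := eS a hab hca.symm
  have eRc := eR c hca hbc.symm
  rw [wb, wc, wa] at eSa
  rw [wb, wc] at hF ⊢
  rw [wc] at yb
  rw [wb] at yc
  rw [wa] at ya
  have hcol : cycInt n a c b := by
    simp only [cyc_iff, val_ne] at *; omega
  by_cases hrow : cycInt n (x a) (x c) (x b)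
  · refine mk_alt hF b c a c (x b) (x c) (x a) (x b) hbc hca.symm rfl rfl ?_ ?_ ?_
    · intro w' w1 w2 w3
      have wa' := w3 a hab hca.symm
      refine ⟨⟨wa', w2, ya, yc, ?_⟩, ?_, ?_⟩
      · intro k h1 h2
        by_cases h3 : k = b
        · rw [h3, w1, yb]
        · rw [yk' k h1 h3 h2, w3 k h3 h2]
      · rintro rfl
        exact hAB (wa'.symm.trans wa)
      · intro k h1 h2 h3
        by_cases h4 : k = b
        · subst h4; rw [w1]; simp only [cyc_iff, val_ne] at *; omega
        · rw [w3 k h4 h2]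
          rcases (cyc_or hcol k).1 h3 with h5 | h5
          · exact eR k h1 h4 h5
          · intro h6
            exact eS' k h1 h4 h2 h5 ((cyc_or hrow _).2 (Or.inl h6))
    · intro k h1 h2 h3
      by_cases h4 : k = a
      · subst h4; simp only [cyc_iff, val_ne] at *; omega
      · intro h6
        exact eS' k h4 h1 h2 h3 ((cyc_or hrow _).2 (Or.inr h6))
    · intro i j
      simp only [rf, Pi.add_apply, ind_add hrow, ind_add hcol]
      ring
  · have hrow' : cycInt n (x a) (x b) (x c) := by
      simp only [cyc_iff, val_ne] at *; omega
    refine mk_alt hF a c a b (x a) (x c) (x c) (x b) hca.symm hab rfl rfl ?_ ?_ ?_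
    · intro w' w1 w2 w3
      have wb' := w3 b hab.symm hbc
      refine ⟨⟨w1, wb', ya, yb, ?_⟩, ?_, ?_⟩
      · intro k h1 h2
        by_cases h3 : k = c
        · rw [h3, w2, yc]
        · rw [yk' k h1 h2 h3, w3 k h1 h3]
      · rintro rfl
        exact hBC (wa.symm.trans w1)
      · intro k h1 h2 h3
        by_cases h4 : k = c
        · subst h4; rw [w2]; simp only [cyc_iff, val_ne] at *; omega
        · rw [w3 k h1 h4]
          intro h6
          exact eR k h1 h2 h3 ((cyc_or hrow' _).2 (Or.inr h6))
    · intro k h1 h2 h3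
      by_cases h4 : k = b
      · subst h4; simp only [cyc_iff, val_ne] at *; omega
      · intro h6
        rcases (cyc_or hcol k).1 h3 with h5 | h5
        · exact eR k h1 h4 h5 ((cyc_or hrow' _).2 (Or.inl h6))
        · exact eS' k h1 h4 h2 h5 h6
    · intro i j
      simp only [rf, Pi.add_apply, ind_add hrow', ind_add hcol]
      ring

theorem alt3 {n : ℕ} [NeZero n] {x w y : Equiv.Perm (ZMod n)} {R S : ZMod n → ZMod n → ℤ}
    {a b c : ZMod n} (hR : RD n x w R a b) (hS : RD n w y S c a) (hcb : c ≠ b) :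
    Alt n x w y (R + S) := by
  have hF : (R + S) ((n : ZMod n) - 1) ((n : ZMod n) - 1) = 0 := by
    rw [Pi.add_apply, Pi.add_apply, hR.corner, hS.corner, add_zero]
  obtain ⟨hab, wa, wb, wk, rfl, -, eR⟩ := hR
  obtain ⟨hca, yc, ya, yk, rfl, -, eS⟩ := hS
  have wc := wk c hca hcb
  have yb := yk b hcb.symm hab.symm
  have hAB : x a ≠ x b := x.injective.ne hab
  have hCA : x c ≠ x a := x.injective.ne hca
  have hCB : x c ≠ x b := x.injective.ne hcb
  have yk' : ∀ k, k ≠ a → k ≠ b → k ≠ c → y k = x k := fun k h1 h2 h3 => by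
    rw [yk k h3 h1, wk k h1 h2]
  have eS' : ∀ k, k ≠ a → k ≠ b → k ≠ c → cycInt n c a k → ¬ cycInt n (x c) (x b) (x k) := by
    intro k h1 h2 h3 h4
    have := eS k h3 h1 h4
    rwa [wa, wc, wk k h1 h2] at this
  have eSb := eS b hcb.symm hab.symm
  have eRc := eR c hca hcb
  rw [wa, wc, wb] at eSb
  rw [wa, wc] at hF ⊢
  rw [wa] at yc
  rw [wc] at ya
  rw [wb] at yb
  have hcol : cycInt n c b a := by
    simp only [cyc_iff, val_ne] at *; omega
  by_cases hrow : cycInt n (x c) (x b) (x a)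
  · refine mk_alt hF c a c b (x c) (x a) (x a) (x b) hca hcb rfl rfl ?_ ?_ ?_
    · intro w' w1 w2 w3
      have wb' := w3 b hcb.symm hab.symm
      refine ⟨⟨w1, wb', yc, yb, ?_⟩, ?_, ?_⟩
      · intro k h1 h2
        by_cases h3 : k = a
        · rw [h3, w2, ya]
        · rw [yk' k h3 h2 h1, w3 k h1 h3]
      · rintro rfl
        exact hCB (w2.symm.trans wa)
      · intro k h1 h2 h3
        by_cases h4 : k = a
        · subst h4; rw [w2]; simp only [cyc_iff, val_ne] at *; omega
        · rw [w3 k h1 h4]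
          rcases (cyc_or hcol k).1 h3 with h5 | h5
          · intro h6
            exact eS' k h4 h2 h1 h5 ((cyc_or hrow _).2 (Or.inr h6))
          · exact eR k h4 h2 h5
    · intro k h1 h2 h3
      by_cases h4 : k = b
      · subst h4; simp only [cyc_iff, val_ne] at *; omega
      · intro h6
        exact eS' k h2 h4 h1 h3 ((cyc_or hrow _).2 (Or.inl h6))
    · intro i j
      simp only [rf, Pi.add_apply, ind_add hrow, ind_add hcol]
      ring
  · have hrow' : cycInt n (x a) (x b) (x c) := by
      simp only [cyc_iff, val_ne] at *; omega
    refine mk_alt hF c b a b (x c) (x b) (x a) (x c) hcb hab rfl rfl ?_ ?_ ?_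
    · intro w' w1 w2 w3
      have wa' := w3 a hca.symm hab
      refine ⟨⟨wa', w2, ya, yb, ?_⟩, ?_, ?_⟩
      · intro k h1 h2
        by_cases h3 : k = c
        · rw [h3, w1, yc]
        · rw [yk' k h1 h2 h3, w3 k h3 h2]
      · rintro rfl
        exact hAB (wa'.symm.trans wa)
      · intro k h1 h2 h3
        by_cases h4 : k = c
        · subst h4; rw [w1]; simp only [cyc_iff, val_ne] at *; omega
        · rw [w3 k h4 h2]
          intro h6
          exact eR k h1 h2 h3 ((cyc_or hrow' _).2 (Or.inl h6))
    · intro k h1 h2 h3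
      by_cases h4 : k = a
      · subst h4; simp only [cyc_iff, val_ne] at *; omega
      · intro h6
        rcases (cyc_or hcol k).1 h3 with h5 | h5
        · exact eS' k h4 h2 h1 h5 h6
        · exact eR k h4 h2 h5 ((cyc_or hrow' _).2 (Or.inr h6))
    · intro i j
      simp only [rf, Pi.add_apply, ind_add hrow', ind_add hcol]
      ring

theorem alt4 {n : ℕ} [NeZero n] {x w y : Equiv.Perm (ZMod n)} {R S : ZMod n → ZMod n → ℤ}
    {a b c : ZMod n} (hR : RD n x w R a b) (hS : RD n w y S c b) (hca : c ≠ a) :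
    Alt n x w y (R + S) := by
  have hF : (R + S) ((n : ZMod n) - 1) ((n : ZMod n) - 1) = 0 := by
    rw [Pi.add_apply, Pi.add_apply, hR.corner, hS.corner, add_zero]
  obtain ⟨hab, wa, wb, wk, rfl, -, eR⟩ := hR
  obtain ⟨hcb, yc, yb, yk, rfl, -, eS⟩ := hS
  have wc := wk c hca hcb
  have ya := yk a hca.symm hab
  have hAB : x a ≠ x b := x.injective.ne hab
  have hCA : x c ≠ x a := x.injective.ne hca
  have hCB : x c ≠ x b := x.injective.ne hcb
  have yk' : ∀ k, k ≠ a → k ≠ b → k ≠ c → y k = x k := fun k h1 h2 h3 => by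
    rw [yk k h3 h2, wk k h1 h2]
  have eS' : ∀ k, k ≠ a → k ≠ b → k ≠ c → cycInt n c b k → ¬ cycInt n (x c) (x a) (x k) := by
    intro k h1 h2 h3 h4
    have := eS k h3 h2 h4
    rwa [wb, wc, wk k h1 h2] at this
  have eSa := eS a hca.symm hab
  have eRc := eR c hca hcb
  rw [wb, wc, wa] at eSa
  rw [wb, wc] at hF ⊢
  rw [wb] at yc
  rw [wc] at yb
  rw [wa] at ya
  have hrow : cycInt n (x c) (x b) (x a) := by
    simp only [cyc_iff, val_ne] at *; omega
  by_cases hcol : cycInt n a b c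
  · refine mk_alt hF c b a c (x c) (x b) (x a) (x b) hcb hca.symm rfl rfl ?_ ?_ ?_
    · intro w' w1 w2 w3
      have wa' := w3 a hca.symm hab
      refine ⟨⟨wa', w1, ya, yc, ?_⟩, ?_, ?_⟩
      · intro k h1 h2
        by_cases h3 : k = b
        · rw [h3, w2, yb]
        · rw [yk' k h1 h3 h2, w3 k h2 h3]
      · rintro rfl
        exact hAB (wa'.symm.trans wa)
      · intro k h1 h2 h3
        by_cases h4 : k = b
        · subst h4; rw [w2]; simp only [cyc_iff, val_ne] at *; omega
        · rw [w3 k h2 h4]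
          exact eR k h1 h4 ((cyc_or hcol k).2 (Or.inl h3))
    · intro k h1 h2 h3
      by_cases h4 : k = a
      · subst h4; simp only [cyc_iff, val_ne] at *; omega
      · intro h6
        rcases (cyc_or hrow _).1 h6 with h5 | h5
        · exact eS' k h4 h2 h1 h3 h5
        · exact eR k h4 h2 ((cyc_or hcol k).2 (Or.inr h3)) h5
    · intro i j
      simp only [rf, Pi.add_apply, ind_add hrow, ind_add hcol]
      ring
  · have hcol' : cycInt n c b a := by
      simp only [cyc_iff, val_ne] at *; omega
    refine mk_alt hF c a a b (x c) (x a) (x c) (x b) hca hab rfl rfl ?_ ?_ ?_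
    · intro w' w1 w2 w3
      have wb' := w3 b hcb.symm hab.symm
      refine ⟨⟨w2, wb', ya, yb, ?_⟩, ?_, ?_⟩
      · intro k h1 h2
        by_cases h3 : k = c
        · rw [h3, w1, yc]
        · rw [yk' k h1 h2 h3, w3 k h3 h1]
      · rintro rfl
        exact hCB (w2.symm.trans wa)
      · intro k h1 h2 h3
        by_cases h4 : k = c
        · subst h4; rw [w1]; simp only [cyc_iff, val_ne] at *; omega
        · rw [w3 k h4 h1]
          intro h6
          rcases (cyc_or hrow _).1 h6 with h5 | h5
          · exact eS' k h1 h2 h4 ((cyc_or hcol' k).2 (Or.inr h3)) h5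
          · exact eR k h1 h2 h3 h5
    · intro k h1 h2 h3
      by_cases h4 : k = b
      · subst h4; simp only [cyc_iff, val_ne] at *; omega
      · exact eS' k h2 h4 h1 ((cyc_or hcol' k).2 (Or.inl h3))
    · intro i j
      simp only [rf, Pi.add_apply, ind_add hrow, ind_add hcol']
      ring

theorem ov1 {n : ℕ} [NeZero n] {p q r t : ZMod n} (h1 : cycInt n r t p) (h2 : ¬ cycInt n r t q)
    (h3 : t ≠ q) : cycInt n p q t := by
  simp only [cyc_iff, val_ne] at *; omega

theorem ov2 {n : ℕ} [NeZero n] {p q r t : ZMod n} (h1 : cycInt n r t q) (h2 : ¬ cycInt n r t p)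
    (h3 : q ≠ r) : cycInt n p q r := by
  simp only [cyc_iff, val_ne] at *; omega

theorem alt0 {n : ℕ} [NeZero n] {x w y : Equiv.Perm (ZMod n)} {R S : ZMod n → ZMod n → ℤ}
    {a b c d : ZMod n} (hR : RD n x w R a b) (hS : RD n w y S c d) (hca : c ≠ a) (hcb : c ≠ b)
    (hda : d ≠ a) (hdb : d ≠ b) :
    Alt n x w y (R + S) := by
  have hF : (R + S) ((n : ZMod n) - 1) ((n : ZMod n) - 1) = 0 := by
    rw [Pi.add_apply, Pi.add_apply, hR.corner, hS.corner, add_zero]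
  obtain ⟨hab, wa, wb, wk, rfl, -, eR⟩ := hR
  obtain ⟨hcd, yc, yd, yk, rfl, -, eS⟩ := hS
  have wc := wk c hca hcb
  have wd := wk d hda hdb
  have ya := yk a hca.symm hda.symm
  have yb := yk b hcb.symm hdb.symm
  have hAB : x a ≠ x b := x.injective.ne hab
  have hCD : x c ≠ x d := x.injective.ne hcd
  have hCA : x c ≠ x a := x.injective.ne hca
  have hCB : x c ≠ x b := x.injective.ne hcb
  have hDA : x d ≠ x a := x.injective.ne hda
  have hDB : x d ≠ x b := x.injective.ne hdb
  have eSa := eS a hca.symm hda.symm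
  have eSb := eS b hcb.symm hdb.symm
  have eRc := eR c hca hcb
  have eRd := eR d hda hdb
  rw [wc, wd, wa] at eSa
  rw [wc, wd, wb] at eSb
  rw [wc, wd] at hF ⊢
  rw [wd] at yc
  rw [wc] at yd
  rw [wa] at ya
  rw [wb] at yb
  refine mk_alt hF c d a b (x c) (x d) (x a) (x b) hcd hab rfl rfl ?_ ?_ ?_
  · intro w' w1 w2 w3
    have wa' := w3 a hca.symm hda.symm
    have wb' := w3 b hcb.symm hdb.symm
    refine ⟨⟨wa', wb', ya, yb, ?_⟩, ?_, ?_⟩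
    · intro k h1 h2
      by_cases h3 : k = c
      · rw [h3, w1, yc]
      · by_cases h4 : k = d
        · rw [h4, w2, yd]
        · rw [yk k h3 h4, w3 k h3 h4, wk k h1 h2]
    · rintro rfl
      exact hAB (wa'.symm.trans wa)
    · intro k h1 h2 h3
      by_cases h4 : k = c
      · subst h4; rw [w1]; intro h6; exact eSb (ov1 h3 (fun h => eRd h h6) hdb.symm) (ov2 h6 (eRc h3) hDA)
      · by_cases h5 : k = d
        · subst h5; rw [w2]; intro h6; exact eSa (ov2 h3 (fun h => eRc h h6) hda) (ov1 h6 (eRd h3) hDB.symm)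
        · rw [w3 k h4 h5]
          exact eR k h1 h2 h3
  · intro k h1 h2 h3
    by_cases h4 : k = a
    · subst h4; intro h6; exact eRd (ov1 h3 (fun h => eSb h h6) hdb) (ov1 h6 (eSa h3) hDB)
    · by_cases h5 : k = b
      · subst h5; intro h6; exact eRc (ov2 h3 (fun h => eSa h h6) hcb.symm) (ov2 h6 (eSb h3) hCB.symm)
      · have := eS k h1 h2 h3
        rwa [wc, wd, wk k h4 h5] at this
  · intro i j
    simp only [rf, Pi.add_apply]
    ring

theorem succ_cases {n : ℕ} [NeZero n] {a b : ZMod n} (h : a ≠ b) :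
    b = a + 1 ∨ (a + 1 ≠ a ∧ a + 1 ≠ b ∧ cycInt n a b (a + 1)) := by
  by_cases hb : b = a + 1
  · exact Or.inl hb
  · right
    have h1 : (1 : ZMod n) ≠ 0 := by
      intro h0
      have : Subsingleton (ZMod n) := subsingleton_of_zero_eq_one h0.symm
      exact h (Subsingleton.elim _ _)
    refine ⟨by simpa using h1, fun h => hb h.symm, 1, ?_, by simp⟩
    have h2 : (b - a).val ≠ 0 := by
      rw [Ne, ZMod.val_eq_zero, sub_eq_zero]; exact h.symm
    have h3 : (b - a).val ≠ 1 := by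
      intro h3
      apply hb
      have := ZMod.natCast_zmod_val (b - a)
      rw [h3] at this
      rw [Nat.cast_one] at this
      rw [this]; ring
    omega

theorem ind_succ {n : ℕ} [NeZero n] {a : ZMod n} (h : a ≠ a + 1) (i : ZMod n) :
    ind n a (a + 1) i = if i = a then 1 else 0 := by
  have h1 : (1 : ZMod n) ≠ 0 := by
    intro h0
    rw [h0] at h; simp at h
  have hv : (1 : ZMod n).val = 1 := by
    have : Fact (1 < n) := ⟨by
      have := NeZero.ne n
      by_contra hc
      have : n = 1 := by omega
      subst this
      exact h1 (Subsingleton.elim _ _)⟩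
    exact ZMod.val_one n
  unfold ind
  have : cycInt n a (a + 1) i ↔ i = a := by
    rw [cyc_iff_val, add_sub_cancel_left, hv, Nat.lt_one_iff, ZMod.val_eq_zero, sub_eq_zero]
  simp only [this]

theorem ind_compl {n : ℕ} [NeZero n] {a b : ZMod n} (h : a ≠ b) (i : ZMod n) :
    ind n a b i + ind n b a i = 1 := by
  unfold ind
  simp only [cyc_iff, val_ne] at *
  split_ifs <;> omega

theorem cyc_compl {n : ℕ} [NeZero n] {a b : ZMod n} (h : a ≠ b) (i : ZMod n) :
    cycInt n a b i ∨ cycInt n b a i := by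
  simp only [cyc_iff, val_ne] at *
  omega

theorem cyc_self {n : ℕ} [NeZero n] {a b : ZMod n} (h : a ≠ b) : cycInt n a b a := by
  simp only [cyc_iff, val_ne] at *
  omega

theorem ann5 {n : ℕ} [NeZero n] {x w y : Equiv.Perm (ZMod n)} {R S : ZMod n → ZMod n → ℤ}
    {a b : ZMod n} (hR : RD n x w R a b) (hS : RD n w y S a b) :
    a ≠ (n : ZMod n) - 1 ∧ R + S = annV n a := by
  have hF : (R + S) ((n : ZMod n) - 1) ((n : ZMod n) - 1) = 0 := by
    rw [Pi.add_apply, Pi.add_apply, hR.corner, hS.corner, add_zero]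
  have key : R + S = annV n a := by
    obtain ⟨hab, wa, wb, wk, rfl, -, eR⟩ := hR
    obtain ⟨-, ya, yb, yk, rfl, -, eS⟩ := hS
    have hAB : x a ≠ x b := x.injective.ne hab
    rcases succ_cases hab with rfl | ⟨h1, h2, h3⟩
    · rw [wa, wb]
      funext i j
      simp only [rf, annV, Pi.add_apply]
      rw [← mul_add, ind_compl hAB, mul_one, ind_succ hab]
    · exfalso
      have e1 := eR _ h1 h2 h3
      have e2 := eS _ h1 h2 h3
      rw [wa, wb, wk _ h1 h2] at e2
      exact (cyc_compl hAB _).elim e1 e2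
  refine ⟨?_, key⟩
  rintro rfl
  rw [key] at hF
  simp only [annV, if_true] at hF
  omega

theorem ann6 {n : ℕ} [NeZero n] {x w y : Equiv.Perm (ZMod n)} {R S : ZMod n → ZMod n → ℤ}
    {a b : ZMod n} (hR : RD n x w R a b) (hS : RD n w y S b a) :
    x a ≠ (n : ZMod n) - 1 ∧ R + S = annH n (x a) := by
  have hF : (R + S) ((n : ZMod n) - 1) ((n : ZMod n) - 1) = 0 := by
    rw [Pi.add_apply, Pi.add_apply, hR.corner, hS.corner, add_zero]
  have key : R + S = annH n (x a) := by
    obtain ⟨hab, wa, wb, wk, rfl, -, eR⟩ := hR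
    obtain ⟨-, ya, yb, yk, rfl, -, eS⟩ := hS
    have hAB : x a ≠ x b := x.injective.ne hab
    rcases succ_cases hAB with h | ⟨h1, h2, h3⟩
    · rw [wa, wb]
      funext i j
      simp only [rf, annH, Pi.add_apply]
      rw [← add_mul, ind_compl hab, one_mul, h, ind_succ (h ▸ hAB)]
    · exfalso
      obtain ⟨k, hk⟩ := x.surjective (x a + 1)
      rw [← hk] at h1 h2 h3
      have h1' : k ≠ a := fun h => h1 (by rw [h])
      have h2' : k ≠ b := fun h => h2 (by rw [h])
      rcases cyc_compl hab k with h | h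
      · exact eR k h1' h2' h h3
      · have := eS k h2' h1' h
        rw [wa, wb, wk _ h1' h2'] at this
        exact this h3
  refine ⟨?_, key⟩
  intro h
  rw [key, h] at hF
  simp only [annH, if_true] at hF
  omega

theorem alt_main {n : ℕ} [NeZero n] {x w y : Equiv.Perm (ZMod n)} {R S : ZMod n → ZMod n → ℤ}
    (hR : IsGridRect n x w R) (hS : IsGridRect n w y S) :
    Alt n x w y (R + S) ∨ (∃ j, j ≠ (n : ZMod n) - 1 ∧ R + S = annH n j) ∨
      (∃ i, i ≠ (n : ZMod n) - 1 ∧ R + S = annV n i) := by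
  obtain ⟨a, b, hR⟩ := RD_of_rect hR
  obtain ⟨c, d, hS⟩ := RD_of_rect hS
  by_cases h1 : c = a
  · subst h1
    by_cases h2 : d = b
    · subst h2; exact Or.inr (Or.inr ⟨_, ann5 hR hS⟩)
    · exact Or.inl (alt1 hR hS h2)
  · by_cases h2 : c = b
    · subst h2
      by_cases h3 : d = a
      · subst h3; exact Or.inr (Or.inl ⟨_, ann6 hR hS⟩)
      · exact Or.inl (alt2 hR hS h3)
    · by_cases h3 : d = a
      · subst h3; exact Or.inl (alt3 hR hS h2)
      · by_cases h4 : d = b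
        · subst h4; exact Or.inl (alt4 hR hS h1)
        · exact Or.inl (alt0 hR hS h1 h2 h3 h4)

theorem rd_swap {n : ℕ} {x : Equiv.Perm (ZMod n)} {a b A B : ZMod n}
    (hA : x a = A) (hB : x b = B) (hab : a ≠ b)
    (hc : rf n a b A B ((n : ZMod n) - 1) ((n : ZMod n) - 1) = 0)
    (he : ∀ k, k ≠ a → k ≠ b → cycInt n a b k → ¬ cycInt n A B (x k)) :
    RD n x (x * Equiv.swap a b) (rf n a b A B) a b := by
  subst hA hB
  exact ⟨hab, by simp, by simp,
      fun k h1 h2 => by simp [Equiv.swap_apply_of_ne_of_ne h1 h2], rfl, hc, he⟩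

theorem ne_succ {n : ℕ} {j : ZMod n} (h : j ≠ (n : ZMod n) - 1) : j ≠ j + 1 := by
  intro h1
  have h0 : (1 : ZMod n) = 0 := by simpa using h1
  have : Subsingleton (ZMod n) := subsingleton_of_zero_eq_one h0.symm
  exact h (Subsingleton.elim _ _)

theorem cyc_succ {n : ℕ} [NeZero n] {a i : ZMod n} (h : a ≠ a + 1) :
    cycInt n a (a + 1) i ↔ i = a := by
  have := ind_succ h i
  unfold ind at this
  split_ifs at this <;> simp_all

theorem exH {n : ℕ} [NeZero n] (x : Equiv.Perm (ZMod n)) {j : ZMod n}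
    (hj : j ≠ (n : ZMod n) - 1) :
    ∃ w R S, IsGridRect n x w R ∧ IsGridRect n w x S ∧ R + S = annH n j := by
  have hj1 := ne_succ hj
  obtain ⟨a, ha⟩ := x.surjective j
  obtain ⟨b, hb⟩ := x.surjective (j + 1)
  have hab : a ≠ b := by rintro rfl; exact hj1 (ha.symm.trans hb)
  have hs : rf n a b j (j + 1) + rf n b a j (j + 1) = annH n j := by
    funext p q
    simp only [rf, annH, Pi.add_apply]
    rw [← add_mul, ind_compl hab, one_mul, ind_succ hj1]
  have c := congrFun (congrFun hs ((n : ZMod n) - 1)) ((n : ZMod n) - 1)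
  simp only [Pi.add_apply, annH, if_neg hj.symm] at c
  have c1 := rf_nonneg a b j (j + 1) ((n : ZMod n) - 1) ((n : ZMod n) - 1)
  have c2 := rf_nonneg b a j (j + 1) ((n : ZMod n) - 1) ((n : ZMod n) - 1)
  refine ⟨x * Equiv.swap a b, _, _, (rd_swap ha hb hab (by omega) ?_).rect, ?_, hs⟩
  · intro k h1 h2 h3
    rw [cyc_succ hj1]
    intro h4
    exact h1 (x.injective (h4.trans ha.symm))
  · have := (rd_swap (x := x * Equiv.swap a b) (a := b) (b := a) (A := j) (B := j + 1)
      (by simp [ha]) (by simp [hb]) hab.symm (by omega) ?_).rect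
    · rwa [mul_assoc, Equiv.swap_comm b a, Equiv.swap_mul_self, mul_one] at this
    · intro k h1 h2 h3
      rw [cyc_succ hj1]
      intro h4
      rw [Equiv.Perm.mul_apply, Equiv.swap_apply_of_ne_of_ne h2 h1] at h4
      exact h2 (x.injective (h4.trans ha.symm))

theorem exV {n : ℕ} [NeZero n] (x : Equiv.Perm (ZMod n)) {a : ZMod n}
    (hj : a ≠ (n : ZMod n) - 1) :
    ∃ w R S, IsGridRect n x w R ∧ IsGridRect n w x S ∧ R + S = annV n a := by
  have hj1 := ne_succ hj
  have hAB : x a ≠ x (a + 1) := x.injective.ne hj1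
  have hs : rf n a (a + 1) (x a) (x (a + 1)) + rf n a (a + 1) (x (a + 1)) (x a) = annV n a := by
    funext p q
    simp only [rf, annV, Pi.add_apply]
    rw [← mul_add, ind_compl hAB, mul_one, ind_succ hj1]
  have c := congrFun (congrFun hs ((n : ZMod n) - 1)) ((n : ZMod n) - 1)
  simp only [Pi.add_apply, annV, if_neg hj.symm] at c
  have c1 := rf_nonneg a (a + 1) (x a) (x (a + 1)) ((n : ZMod n) - 1) ((n : ZMod n) - 1)
  have c2 := rf_nonneg a (a + 1) (x (a + 1)) (x a) ((n : ZMod n) - 1) ((n : ZMod n) - 1)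
  refine ⟨x * Equiv.swap a (a + 1), _, _, (rd_swap rfl rfl hj1 (by omega) ?_).rect, ?_, hs⟩
  · intro k h1 h2 h3
    exact absurd ((cyc_succ hj1).1 h3) h1
  · have := (rd_swap (x := x * Equiv.swap a (a + 1)) (a := a) (b := a + 1) (A := x (a + 1))
      (B := x a) (by simp) (by simp) hj1 (by omega) ?_).rect
    · rwa [mul_assoc, Equiv.swap_mul_self, mul_one] at this
    · intro k h1 h2 h3
      exact absurd ((cyc_succ hj1).1 h3) h1

theorem rf_le {n : ℕ} {x w y : Equiv.Perm (ZMod n)} {R S F : ZMod n → ZMod n → ℤ} {a b : ZMod n}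
    (hR : RD n x w R a b) (hS : IsGridRect n w y S) (hF : R + S = F) {i j : ZMod n}
    (hi : cycInt n a b i) (hj : cycInt n (x a) (x b) j) : 1 ≤ F i j := by
  have h1 := hS.1.2 i j
  have h2 : R i j = 1 := by
    rw [hR.R_eq]; simp [rf, ind, hi, hj]
  rw [← hF]
  simp only [Pi.add_apply]
  omega

theorem uniqH {n : ℕ} [NeZero n] {x w y : Equiv.Perm (ZMod n)} {R S : ZMod n → ZMod n → ℤ}
    {j : ZMod n} (hR : IsGridRect n x w R) (hS : IsGridRect n w y S)
    (hF : R + S = annH n j) :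
    w = x * Equiv.swap (x.symm j) (x.symm (j + 1)) ∧
      R = rf n (x.symm j) (x.symm (j + 1)) j (j + 1) := by
  obtain ⟨a, b, h⟩ := RD_of_rect hR
  have hAB : x a ≠ x b := x.injective.ne h.ne
  have key : ∀ q, cycInt n (x a) (x b) q → q = j := by
    intro q hq
    have := rf_le h hS hF (cyc_self h.ne) hq
    by_contra hne
    simp [annH, hne] at this
  have h1 := key _ (cyc_self hAB)
  have h2 : x b = j + 1 := by
    rcases succ_cases hAB with h2 | ⟨h2, h3, h4⟩
    · rw [h2, h1]
    · exact absurd ((key _ h4).trans h1.symm) h2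
  have e1 : x.symm j = a := by rw [← h1]; simp
  have e2 : x.symm (j + 1) = b := by rw [← h2]; simp
  rw [e1, e2]
  refine ⟨?_, by rw [h.R_eq, h2, h1]⟩
  ext k
  by_cases ha : k = a
  · subst ha; simp [h.ya]
  · by_cases hb : k = b
    · subst hb; simp [h.yb]
    · rw [h.yk k ha hb]; simp [Equiv.swap_apply_of_ne_of_ne ha hb]

theorem uniqV {n : ℕ} [NeZero n] {x w y : Equiv.Perm (ZMod n)} {R S : ZMod n → ZMod n → ℤ}
    {j : ZMod n} (hR : IsGridRect n x w R) (hS : IsGridRect n w y S)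
    (hF : R + S = annV n j) :
    w = x * Equiv.swap j (j + 1) ∧
      R = rf n j (j + 1) (x j) (x (j + 1)) := by
  obtain ⟨a, b, h⟩ := RD_of_rect hR
  have hAB : x a ≠ x b := x.injective.ne h.ne
  have key : ∀ q, cycInt n a b q → q = j := by
    intro q hq
    have := rf_le h hS hF hq (cyc_self hAB)
    by_contra hne
    simp [annV, hne] at this
  have h1 := key _ (cyc_self h.ne)
  have h2 : b = j + 1 := by
    rcases succ_cases h.ne with h2 | ⟨h2, h3, h4⟩
    · rw [h2, h1]
    · exact absurd ((key _ h4).trans h1.symm) h2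
  subst h1 h2
  refine ⟨?_, h.R_eq⟩
  ext k
  by_cases ha : k = a
  · subst ha; simp [h.ya]
  · by_cases hb : k = a + 1
    · subst hb; simp [h.yb]
    · rw [h.yk k ha hb]; simp [Equiv.swap_apply_of_ne_of_ne ha hb]

theorem pos_add {n : ℕ} {x w y : Equiv.Perm (ZMod n)} {D E : ZMod n → ZMod n → ℤ}
    (h1 : IsGridPosDomain n x w D) (h2 : IsGridPosDomain n w y E) :
    IsGridPosDomain n x y (D + E) := by
  refine ⟨⟨?_, ?_⟩, ?_⟩
  · rw [Pi.add_apply, Pi.add_apply, h1.1.1, h2.1.1, add_zero]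
  · intro i j
    have e1 := h1.1.2 i j
    have e2 := h2.1.2 i j
    simp only [Pi.add_apply]
    linarith
  · intro i j
    have e1 := h1.2 i j
    have e2 := h2.2 i j
    simp only [Pi.add_apply]
    linarith

theorem eq_of_ann {n : ℕ} {x y : Equiv.Perm (ZMod n)} {F : ZMod n → ZMod n → ℤ}
    (h : IsGridPosDomain n x y F)
    (hF : (∃ j, F = annH n j) ∨ (∃ i, F = annV n i)) : y = x := by
  refine Equiv.ext fun k => ?_
  have := h.1.2 k (x k)
  by_contra hne
  rw [if_pos rfl, if_neg hne] at this
  rcases hF with ⟨j, rfl⟩ | ⟨i, rfl⟩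
  · simp only [annH] at this; omega
  · simp only [annV] at this; omega

section algebra

set_option linter.unusedSectionVars false

open Classical

variable {n : ℕ} [NeZero n] (sgn : SignAssignment n) (grd : MaslovGrading n)

/-- 0/1 valued functions -/
noncomputable def T (n : ℕ) [NeZero n] : Finset (ZMod n → ZMod n → ℤ) :=
  Fintype.piFinset fun _ => Fintype.piFinset fun _ => {0, 1}

theorem mem_T {x y : Equiv.Perm (ZMod n)} {R : ZMod n → ZMod n → ℤ} (h : IsGridRect n x y R) :
    R ∈ T n := by
  obtain ⟨-, a, b, -, -, hR, -⟩ := h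
  simp only [T, Fintype.mem_piFinset, Finset.mem_insert, Finset.mem_singleton]
  intro i j
  by_cases hc : cycInt n a b i ∧ cycInt n (x a) (x b) j
  · exact Or.inr ((hR i j).1 hc)
  · exact Or.inl ((hR i j).2 hc)

/-- sign extended by zero -/
noncomputable def sg (x w : Equiv.Perm (ZMod n)) (R : ZMod n → ZMod n → ℤ) : ℤ :=
  if IsGridRect n x w R then sgn.s x w R else 0

/-- generator extended by zero -/
noncomputable def gen (x y : Equiv.Perm (ZMod n)) (E : ZMod n → ZMod n → ℤ) : CDModule n :=
  if h : IsGridPosDomain n x y E then Finsupp.single (⟨(x, y, E), h⟩ : GenCD n) (1 : ℤ) else 0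

/-- sign of the grading -/
noncomputable def eps (x y : Equiv.Perm (ZMod n)) (E : ZMod n → ZMod n → ℤ) : ℤ :=
  (((-1 : ℤˣ) ^ grd.gr x y E : ℤˣ) : ℤ)

theorem finsum_left (x y : Equiv.Perm (ZMod n)) (D : ZMod n → ZMod n → ℤ) :
    (∑ᶠ (w : Equiv.Perm (ZMod n)) (R : ZMod n → ZMod n → ℤ) (E : ZMod n → ZMod n → ℤ)
        (_ : IsGridRect n x w R) (hE : IsGridPosDomain n w y E)
        (_ : R + E = D),
        sgn.s x w R • Finsupp.single (⟨(w, y, E), hE⟩ : GenCD n) (1 : ℤ)) =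
    ∑ w, ∑ R ∈ T n, sg sgn x w R • gen w y (D - R) := by
  rw [finsum_eq_sum_of_fintype]
  refine Finset.sum_congr rfl fun w _ => ?_
  rw [finsum_eq_sum_of_support_subset (s := T n)]
  · refine Finset.sum_congr rfl fun R _ => ?_
    rw [finsum_eq_single _ (D - R)]
    · unfold sg gen
      by_cases h1 : IsGridRect n x w R
      · by_cases h2 : IsGridPosDomain n w y (D - R)
        · simp [h1, h2]
        · simp [h2]
      · simp [h1]
    · intro E hE
      have : R + E ≠ D := by rintro rfl; simp at hE
      simp [this]
  · intro R hR
    by_contra hT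
    have : ¬ IsGridRect n x w R := fun h => hT (mem_T h)
    simp [this] at hR

theorem finsum_right (x y : Equiv.Perm (ZMod n)) (D : ZMod n → ZMod n → ℤ) :
    (∑ᶠ (w : Equiv.Perm (ZMod n)) (E : ZMod n → ZMod n → ℤ) (R : ZMod n → ZMod n → ℤ)
        (hE : IsGridPosDomain n x w E) (_ : IsGridRect n w y R)
        (_ : E + R = D),
        sgn.s w y R • Finsupp.single (⟨(x, w, E), hE⟩ : GenCD n) (1 : ℤ)) =
    ∑ w, ∑ R ∈ T n, sg sgn w y R • gen x w (D - R) := by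
  rw [finsum_eq_sum_of_fintype]
  refine Finset.sum_congr rfl fun w _ => ?_
  have inj : Function.Injective (fun R : ZMod n → ZMod n → ℤ => D - R) := sub_right_injective
  have e1 : ∀ E : ZMod n → ZMod n → ℤ, (∑ᶠ (R : ZMod n → ZMod n → ℤ)
        (hE : IsGridPosDomain n x w E) (_ : IsGridRect n w y R)
        (_ : E + R = D),
        sgn.s w y R • Finsupp.single (⟨(x, w, E), hE⟩ : GenCD n) (1 : ℤ)) =
        sg sgn w y (D - E) • gen x w E := by
    intro E
    rw [finsum_eq_single _ (D - E)]
    · unfold sg gen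
      by_cases h1 : IsGridRect n w y (D - E)
      · by_cases h2 : IsGridPosDomain n x w E
        · simp [h1, h2]
        · simp [h2]
      · simp [h1]
    · intro R hR
      have : E + R ≠ D := by rintro rfl; simp at hR
      simp [this]
  simp only [e1]
  rw [finsum_eq_sum_of_support_subset (s := (T n).image (fun R => D - R))]
  · rw [Finset.sum_image (inj.injOn)]
    simp
  · intro E hE
    by_contra hT
    have : ¬ IsGridRect n w y (D - E) := fun h => hT (by
      simp only [Finset.coe_image, Set.mem_image]
      exact ⟨D - E, mem_T h, by simp⟩)
    simp [this, sg] at hE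

/-- left part -/
noncomputable def Lp (x y : Equiv.Perm (ZMod n)) (D : ZMod n → ZMod n → ℤ) : CDModule n :=
  ∑ w, ∑ R ∈ T n, sg sgn x w R • gen w y (D - R)

/-- right part -/
noncomputable def Rp (x y : Equiv.Perm (ZMod n)) (D : ZMod n → ZMod n → ℤ) : CDModule n :=
  ∑ w, ∑ R ∈ T n, sg sgn w y R • gen x w (D - R)

theorem delta_single (g : GenCD n) :
    deltaCD n sgn grd (Finsupp.single g 1) =
      Lp sgn g.1.1 g.1.2.1 g.1.2.2 +
        eps grd g.1.1 g.1.2.1 g.1.2.2 • Rp sgn g.1.1 g.1.2.1 g.1.2.2 := by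
  unfold deltaCD
  rw [Finsupp.lift_apply, Finsupp.sum_single_index (by simp), one_smul, finsum_left, finsum_right]
  rfl

theorem pos_left {x w y : Equiv.Perm (ZMod n)} {R D : ZMod n → ZMod n → ℤ}
    (h1 : IsGridRect n x w R) (h2 : IsGridPosDomain n w y (D - R)) : IsGridPosDomain n x y D := by
  have := pos_add h1.1 h2
  rwa [add_sub_cancel] at this

theorem pos_right {x w y : Equiv.Perm (ZMod n)} {R D : ZMod n → ZMod n → ℤ}
    (h1 : IsGridRect n w y R) (h2 : IsGridPosDomain n x w (D - R)) : IsGridPosDomain n x y D := by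
  have := pos_add h2 h1.1
  rwa [sub_add_cancel] at this

theorem delta_gen (x y : Equiv.Perm (ZMod n)) (D : ZMod n → ZMod n → ℤ) :
    deltaCD n sgn grd (gen x y D) = Lp sgn x y D + eps grd x y D • Rp sgn x y D := by
  by_cases h : IsGridPosDomain n x y D
  · rw [gen, dif_pos h, delta_single]
  · have h1 : Lp sgn x y D = 0 := by
      refine Finset.sum_eq_zero fun w _ => Finset.sum_eq_zero fun R _ => ?_
      unfold sg gen
      split_ifs with h1 h2
      · exact absurd (pos_left h1 h2) h
      all_goals simp
    have h2 : Rp sgn x y D = 0 := by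
      refine Finset.sum_eq_zero fun w _ => Finset.sum_eq_zero fun R _ => ?_
      unfold sg gen
      split_ifs with h1 h2
      · exact absurd (pos_right h1 h2) h
      all_goals simp
    rw [gen, dif_neg h, h1, h2]; simp

theorem eps_left {x w y : Equiv.Perm (ZMod n)} {R D : ZMod n → ZMod n → ℤ}
    (h1 : IsGridRect n x w R) (h2 : IsGridPosDomain n w y (D - R)) :
    eps grd x y D = - eps grd w y (D - R) := by
  have := grd.gr_left x w y R (D - R) h1 h2
  rw [add_sub_cancel] at this
  unfold eps
  rw [this, zpow_add, zpow_one]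
  simp

theorem eps_right {x w y : Equiv.Perm (ZMod n)} {R D : ZMod n → ZMod n → ℤ}
    (h1 : IsGridRect n w y R) (h2 : IsGridPosDomain n x w (D - R)) :
    eps grd x y D = - eps grd x w (D - R) := by
  have := grd.gr_right x w y (D - R) R h2 h1
  rw [sub_add_cancel] at this
  unfold eps
  rw [this, zpow_add, zpow_one]
  simp

theorem eps_sq (x y : Equiv.Perm (ZMod n)) (D : ZMod n → ZMod n → ℤ) :
    eps grd x y D * eps grd x y D = 1 := by
  unfold eps
  rw [← Units.val_mul, Int.units_mul_self, Units.val_one]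

/-- the set of decompositions -/
noncomputable def Dec (x v : Equiv.Perm (ZMod n)) (F : ZMod n → ZMod n → ℤ) :
    Finset (Equiv.Perm (ZMod n) × (ZMod n → ZMod n → ℤ)) :=
  (Finset.univ ×ˢ T n).filter fun p => IsGridRect n x p.1 p.2 ∧ IsGridRect n p.1 v (F - p.2)

/-- signed count of decompositions -/
noncomputable def Pc (x v : Equiv.Perm (ZMod n)) (F : ZMod n → ZMod n → ℤ) : ℤ :=
  ∑ w, ∑ R ∈ T n, sg sgn x w R * sg sgn w v (F - R)

theorem mem_Dec {x v : Equiv.Perm (ZMod n)} {F : ZMod n → ZMod n → ℤ}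
    {p : Equiv.Perm (ZMod n) × (ZMod n → ZMod n → ℤ)} :
    p ∈ Dec x v F ↔ IsGridRect n x p.1 p.2 ∧ IsGridRect n p.1 v (F - p.2) := by
  unfold Dec
  rw [Finset.mem_filter]
  constructor
  · exact fun h => h.2
  · intro h
    exact ⟨by simp [mem_T h.1], h⟩

theorem Pc_eq (x v : Equiv.Perm (ZMod n)) (F : ZMod n → ZMod n → ℤ) :
    Pc sgn x v F = ∑ p ∈ Dec x v F, sgn.s x p.1 p.2 * sgn.s p.1 v (F - p.2) := by
  unfold Pc Dec
  rw [Finset.sum_filter, Finset.sum_product]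
  refine Finset.sum_congr rfl fun w _ => Finset.sum_congr rfl fun R _ => ?_
  unfold sg
  by_cases h1 : IsGridRect n x w R <;> by_cases h2 : IsGridRect n w v (F - R) <;> simp [h1, h2]

theorem Pc_H (x : Equiv.Perm (ZMod n)) {j : ZMod n} (hj : j ≠ (n : ZMod n) - 1) :
    Pc sgn x x (annH n j) = 1 := by
  obtain ⟨w, R, S, h1, h2, h3⟩ := exH x hj
  have hS : S = annH n j - R := by rw [← h3]; simp
  subst hS
  rw [Pc_eq, Finset.sum_eq_single_of_mem (w, R) (mem_Dec.2 ⟨h1, h2⟩)]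
  · exact sgn.s_horiz x w R _ j hj h1 h2 h3
  · rintro ⟨w', R'⟩ hp hne
    obtain ⟨h4, h5⟩ := mem_Dec.1 hp
    obtain ⟨e1, e2⟩ := uniqH h1 h2 h3
    obtain ⟨e3, e4⟩ := uniqH h4 h5 (add_sub_cancel _ _)
    exact absurd (Prod.ext (e3.trans e1.symm) (e4.trans e2.symm)) hne

theorem Pc_V (x : Equiv.Perm (ZMod n)) {j : ZMod n} (hj : j ≠ (n : ZMod n) - 1) :
    Pc sgn x x (annV n j) = -1 := by
  obtain ⟨w, R, S, h1, h2, h3⟩ := exV x hj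
  have hS : S = annV n j - R := by rw [← h3]; simp
  subst hS
  rw [Pc_eq, Finset.sum_eq_single_of_mem (w, R) (mem_Dec.2 ⟨h1, h2⟩)]
  · exact sgn.s_vert x w R _ j hj h1 h2 h3
  · rintro ⟨w', R'⟩ hp hne
    obtain ⟨h4, h5⟩ := mem_Dec.1 hp
    obtain ⟨e1, e2⟩ := uniqV h1 h2 h3
    obtain ⟨e3, e4⟩ := uniqV h4 h5 (add_sub_cancel _ _)
    exact absurd (Prod.ext (e3.trans e1.symm) (e4.trans e2.symm)) hne

theorem Pc_other (x v : Equiv.Perm (ZMod n)) (F : ZMod n → ZMod n → ℤ)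
    (hH : ∀ j : ZMod n, j ≠ (n : ZMod n) - 1 → F ≠ annH n j)
    (hV : ∀ j : ZMod n, j ≠ (n : ZMod n) - 1 → F ≠ annV n j) :
    Pc sgn x v F = 0 := by
  rw [Pc_eq]
  have opp : ∀ p ∈ Dec x v F, ∀ q ∈ Dec x v F, p ≠ q →
      sgn.s x p.1 p.2 * sgn.s p.1 v (F - p.2) = -(sgn.s x q.1 q.2 * sgn.s q.1 v (F - q.2)) := by
    intro p hp q hq hne
    obtain ⟨h1, h2⟩ := mem_Dec.1 hp
    obtain ⟨h3, h4⟩ := mem_Dec.1 hq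
    refine sgn.s_square x v p.1 q.1 p.2 (F - p.2) q.2 (F - q.2) h1 h2 h3 h4 (by simp) ?_ ?_ ?_
    · intro h
      simp only [Prod.mk.injEq] at h
      exact hne (Prod.ext h.1 h.2.1)
    · rwa [add_sub_cancel]
    · rwa [add_sub_cancel]
  rcases (Dec x v F).eq_empty_or_nonempty with h0 | ⟨p, hp⟩
  · rw [h0, Finset.sum_empty]
  · obtain ⟨h1, h2⟩ := mem_Dec.1 hp
    have hm := alt_main h1 h2
    rw [add_sub_cancel] at hm
    rcases hm with ⟨w', R', S', a1, a2, a3, a4⟩ | ⟨j, hj, hj'⟩ | ⟨j, hj, hj'⟩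
    · have hS : S' = F - R' := by rw [← a3]; simp
      subst hS
      have hq : (w', R') ∈ Dec x v F := mem_Dec.2 ⟨a1, a2⟩
      have hpq : p ≠ (w', R') := by rintro rfl; exact a4 rfl
      have hsub : Dec x v F = {p, (w', R')} := by
        ext r
        simp only [Finset.mem_insert, Finset.mem_singleton]
        constructor
        · intro hr
          by_contra hc
          push Not at hc
          have e1 := opp p hp _ hq hpq
          have e2 := opp r hr _ hp hc.1
          have e3 := opp r hr _ hq hc.2
          have u1 := sgn.s_unit _ _ _ a1
          have u2 := sgn.s_unit _ _ _ a2
          have : sgn.s x w' R' * sgn.s w' v (F - R') = 0 := by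
            simp only at e1 e3
            linarith
          rcases u1 with u1 | u1 <;> rcases u2 with u2 | u2 <;> rw [u1, u2] at this <;>
            norm_num at this
        · rintro (rfl | rfl)
          · exact hp
          · exact hq
      rw [hsub, Finset.sum_pair hpq, opp p hp _ hq hpq]
      simp
    · exact absurd hj' (hH j hj)
    · exact absurd hj' (hV j hj)

/-- universal count -/
noncomputable def cc (F : ZMod n → ZMod n → ℤ) : ℤ := Pc sgn 1 1 F

theorem Pc_cc (x v : Equiv.Perm (ZMod n)) (F : ZMod n → ZMod n → ℤ) :
    Pc sgn x v F = if v = x then cc sgn F else 0 := by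
  by_cases hA : (∃ j, F = annH n j) ∨ (∃ i, F = annV n i)
  · by_cases hv : v = x
    · subst hv
      rw [if_pos rfl]
      unfold cc
      by_cases hH : ∃ j : ZMod n, j ≠ (n : ZMod n) - 1 ∧ F = annH n j
      · obtain ⟨j, hj, rfl⟩ := hH
        rw [Pc_H sgn _ hj, Pc_H sgn _ hj]
      · by_cases hV : ∃ j : ZMod n, j ≠ (n : ZMod n) - 1 ∧ F = annV n j
        · obtain ⟨j, hj, rfl⟩ := hV
          rw [Pc_V sgn _ hj, Pc_V sgn _ hj]
        · push Not at hH hV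
          rw [Pc_other sgn _ _ F hH hV, Pc_other sgn _ _ F hH hV]
    · rw [if_neg hv, Pc_eq]
      refine Finset.sum_eq_zero fun p hp => ?_
      obtain ⟨h1, h2⟩ := mem_Dec.1 hp
      have := pos_add h1.1 h2.1
      rw [add_sub_cancel] at this
      exact absurd (eq_of_ann this hA) hv
  · push Not at hA
    have e := fun x v => Pc_other sgn x v F (fun j _ => hA.1 j) (fun j _ => hA.2 j)
    unfold cc
    rw [e, e]; simp

/-- sums of two 0/1 functions -/
noncomputable def T2 (n : ℕ) [NeZero n] : Finset (ZMod n → ZMod n → ℤ) :=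
  (T n ×ˢ T n).image fun p => p.1 + p.2

theorem inner_sum {M : Type*} [AddCommGroup M] (x w v : Equiv.Perm (ZMod n))
    {R : ZMod n → ZMod n → ℤ} (hR : R ∈ T n) (f : (ZMod n → ZMod n → ℤ) → M) :
    ∑ S ∈ T n, (sg sgn x w R * sg sgn w v S) • f (R + S) =
      ∑ F ∈ T2 n, (sg sgn x w R * sg sgn w v (F - R)) • f F := by
  have inj : Function.Injective (fun S : ZMod n → ZMod n → ℤ => R + S) := add_right_injective R
  have e : ∑ S ∈ T n, (sg sgn x w R * sg sgn w v S) • f (R + S) =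
      ∑ F ∈ (T n).image (fun S => R + S), (sg sgn x w R * sg sgn w v (F - R)) • f F := by
    rw [Finset.sum_image inj.injOn]; simp
  rw [e]
  refine Finset.sum_subset ?_ ?_
  · intro F hF
    obtain ⟨S, hS, rfl⟩ := Finset.mem_image.1 hF
    exact Finset.mem_image.2 ⟨(R, S), Finset.mem_product.2 ⟨hR, hS⟩, rfl⟩
  · intro F _ hF
    have : ¬ IsGridRect n w v (F - R) := fun h =>
      hF (Finset.mem_image.2 ⟨F - R, mem_T h, by simp⟩)
    simp [sg, this]

theorem dbl_sum {M : Type*} [AddCommGroup M] (x v : Equiv.Perm (ZMod n))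
    (f : (ZMod n → ZMod n → ℤ) → M) :
    ∑ w, ∑ R ∈ T n, ∑ S ∈ T n, (sg sgn x w R * sg sgn w v S) • f (R + S) =
      ∑ F ∈ T2 n, (if v = x then cc sgn F else 0) • f F := by
  have e : ∀ w, ∑ R ∈ T n, ∑ S ∈ T n, (sg sgn x w R * sg sgn w v S) • f (R + S) =
      ∑ F ∈ T2 n, ∑ R ∈ T n, (sg sgn x w R * sg sgn w v (F - R)) • f F := by
    intro w
    rw [Finset.sum_comm (s := T2 n)]
    exact Finset.sum_congr rfl fun R hR => inner_sum sgn x w v hR f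
  simp only [e]
  rw [Finset.sum_comm]
  refine Finset.sum_congr rfl fun F _ => ?_
  rw [← Pc_cc]
  unfold Pc
  simp only [Finset.sum_smul]

theorem LL (x y : Equiv.Perm (ZMod n)) (D : ZMod n → ZMod n → ℤ) :
    ∑ w, ∑ R ∈ T n, sg sgn x w R • Lp sgn w y (D - R) =
      ∑ F ∈ T2 n, cc sgn F • gen x y (D - F) := by
  have e : ∑ w, ∑ R ∈ T n, sg sgn x w R • Lp sgn w y (D - R) =
      ∑ v, ∑ w, ∑ R ∈ T n, ∑ S ∈ T n,
        (sg sgn x w R * sg sgn w v S) • gen v y (D - (R + S)) := by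
    conv_rhs => rw [Finset.sum_comm]
    refine Finset.sum_congr rfl fun w _ => ?_
    conv_rhs => rw [Finset.sum_comm]
    refine Finset.sum_congr rfl fun R _ => ?_
    unfold Lp
    simp only [Finset.smul_sum, smul_smul, sub_sub]
  rw [e]
  rw [Finset.sum_congr rfl fun v _ => dbl_sum sgn x v (fun F => gen v y (D - F))]
  rw [Finset.sum_eq_single x]
  · simp
  · intro v _ hv
    simp [hv]
  · simp

theorem RR (x y : Equiv.Perm (ZMod n)) (D : ZMod n → ZMod n → ℤ) :
    ∑ w, ∑ R ∈ T n, sg sgn w y R • Rp sgn x w (D - R) =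
      ∑ F ∈ T2 n, cc sgn F • gen x y (D - F) := by
  have e : ∑ w, ∑ R ∈ T n, sg sgn w y R • Rp sgn x w (D - R) =
      ∑ v, ∑ w, ∑ R ∈ T n, ∑ S ∈ T n,
        (sg sgn v w R * sg sgn w y S) • gen x v (D - (R + S)) := by
    conv_rhs => rw [Finset.sum_comm]
    refine Finset.sum_congr rfl fun w _ => ?_
    have : ∀ v, ∑ R ∈ T n, ∑ S ∈ T n,
        (sg sgn v w R * sg sgn w y S) • gen x v (D - (R + S)) =
        ∑ S ∈ T n, ∑ R ∈ T n,
        (sg sgn v w R * sg sgn w y S) • gen x v (D - (R + S)) := fun v => Finset.sum_comm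
    simp only [this]
    conv_rhs => rw [Finset.sum_comm]
    refine Finset.sum_congr rfl fun R _ => ?_
    unfold Rp
    simp only [Finset.smul_sum, smul_smul]
    refine Finset.sum_congr rfl fun v _ => Finset.sum_congr rfl fun S _ => ?_
    rw [mul_comm, sub_sub, add_comm R S]
  rw [e]
  rw [Finset.sum_congr rfl fun v _ => dbl_sum sgn v y (fun F => gen x v (D - F))]
  rw [Finset.sum_eq_single y]
  · simp
  · intro v _ hv
    simp [Ne.symm hv]
  · simp

theorem cross (x y : Equiv.Perm (ZMod n)) (D : ZMod n → ZMod n → ℤ) :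
    (∑ w, ∑ R ∈ T n, sg sgn x w R • eps grd w y (D - R) • Rp sgn w y (D - R)) +
      eps grd x y D • (∑ v, ∑ S ∈ T n, sg sgn v y S • Lp sgn x v (D - S)) = 0 := by
  have e1 : eps grd x y D • (∑ v, ∑ S ∈ T n, sg sgn v y S • Lp sgn x v (D - S)) =
      ∑ w, ∑ R ∈ T n, ∑ v, ∑ S ∈ T n,
        (eps grd x y D * (sg sgn v y S * sg sgn x w R)) • gen w v (D - R - S) := by
    unfold Lp
    simp only [Finset.smul_sum, smul_smul]
    have := fun v : Equiv.Perm (ZMod n) => (Finset.sum_comm (s := T n)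
      (t := (Finset.univ : Finset (Equiv.Perm (ZMod n)))) (f := fun S w => ∑ R ∈ T n,
        (eps grd x y D * (sg sgn v y S * sg sgn x w R)) • gen w v (D - S - R)))
    simp only [this]
    rw [Finset.sum_comm]
    refine Finset.sum_congr rfl fun w _ => ?_
    have := fun v : Equiv.Perm (ZMod n) => (Finset.sum_comm (s := T n)
      (t := T n) (f := fun S R => 
        (eps grd x y D * (sg sgn v y S * sg sgn x w R)) • gen w v (D - S - R)))
    simp only [this]
    rw [Finset.sum_comm]
    simp only [sub_right_comm D]
  rw [e1, ← Finset.sum_add_distrib]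
  refine Finset.sum_eq_zero fun w _ => ?_
  rw [← Finset.sum_add_distrib]
  refine Finset.sum_eq_zero fun R _ => ?_
  unfold Rp
  simp only [Finset.smul_sum, smul_smul]
  rw [← Finset.sum_add_distrib]
  refine Finset.sum_eq_zero fun v _ => ?_
  rw [← Finset.sum_add_distrib]
  refine Finset.sum_eq_zero fun S _ => ?_
  rw [← add_smul]
  by_cases h1 : IsGridRect n x w R
  · by_cases h2 : IsGridRect n v y S
    · by_cases h3 : IsGridPosDomain n w v (D - R - S)
      · rw [eps_left grd h1 (pos_right h2 h3)]
        convert zero_smul ℤ _ using 2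
        ring
      · simp [gen, h3]
    · simp [sg, h2]
  · simp [sg, h1]

theorem RR' (x y : Equiv.Perm (ZMod n)) (D : ZMod n → ZMod n → ℤ) :
    eps grd x y D • (∑ w, ∑ R ∈ T n, sg sgn w y R • eps grd x w (D - R) • Rp sgn x w (D - R)) =
      - ∑ w, ∑ R ∈ T n, sg sgn w y R • Rp sgn x w (D - R) := by
  simp only [Finset.smul_sum, ← Finset.sum_neg_distrib]
  refine Finset.sum_congr rfl fun w _ => Finset.sum_congr rfl fun R _ => ?_
  by_cases h1 : IsGridRect n w y R
  · by_cases h2 : IsGridPosDomain n x w (D - R)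
    · rw [eps_right grd h1 h2, smul_smul, smul_smul, ← neg_smul]
      congr 1
      have := eps_sq grd x w (D - R)
      linear_combination (-sg sgn w y R) * this
    · have : Rp sgn x w (D - R) = 0 := by
        refine Finset.sum_eq_zero fun w _ => Finset.sum_eq_zero fun R _ => ?_
        unfold sg gen
        split_ifs with h3 h4
        · exact absurd (pos_right h3 h4) h2
        all_goals simp
      simp [this]
  · simp [sg, h1]

theorem delta_sq_gen (x y : Equiv.Perm (ZMod n)) (D : ZMod n → ZMod n → ℤ) :
    deltaCD n sgn grd (deltaCD n sgn grd (gen x y D)) = 0 := by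
  rw [delta_gen, map_add, map_smul]
  have e1 : deltaCD n sgn grd (Lp sgn x y D) =
      (∑ w, ∑ R ∈ T n, sg sgn x w R • Lp sgn w y (D - R)) +
      ∑ w, ∑ R ∈ T n, sg sgn x w R • eps grd w y (D - R) • Rp sgn w y (D - R) := by
    rw [Lp]
    simp only [map_sum, map_smul, delta_gen, smul_add, Finset.sum_add_distrib]
  have e2 : deltaCD n sgn grd (Rp sgn x y D) =
      (∑ w, ∑ R ∈ T n, sg sgn w y R • Lp sgn x w (D - R)) +
      ∑ w, ∑ R ∈ T n, sg sgn w y R • eps grd x w (D - R) • Rp sgn x w (D - R) := by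
    rw [Rp]
    simp only [map_sum, map_smul, delta_gen, smul_add, Finset.sum_add_distrib]
  rw [e1, e2, smul_add, RR', LL, RR]
  have := cross sgn grd x y D
  generalize (∑ F ∈ T2 n, cc sgn F • gen x y (D - F)) = u at *
  rw [add_assoc, ← add_assoc (∑ w, _) (eps grd x y D • _), this]
  abel

end algebra

end GridCD

/-- The complex of positive domains is a chain complex: `δ ∘ δ = 0`. -/
theorem deltaCD_comp_deltaCD (n : ℕ) (hn : 1 ≤ n)
    (sgn : SignAssignment n) (grd : MaslovGrading n) :
    deltaCD n sgn grd ∘ₗ deltaCD n sgn grd = 0 := by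
  have : NeZero n := ⟨by omega⟩
  refine Finsupp.lhom_ext' fun g => LinearMap.ext_ring ?_
  have h := GridCD.delta_sq_gen sgn grd g.1.1 g.1.2.1 g.1.2.2
  rw [GridCD.gen, dif_pos g.2] at h
  exact h
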